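/- Let λ, μ be real numbers with λ ≥ 1 and μ > 1/2. Then for every z in the open unit disc 𝕌, the normalized Wright function satisfies |𝒲_{λ,μ}(z)| ≤ (2μ+1)/(2μ−1). -/

import Mathlib

/-- The normalized Wright function
`𝒲_{λ,μ}(z) = z + ∑_{m=1}^∞ (Γ(μ)/(m! Γ(λm+μ))) z^{m+1}`,
written as `∑_{m=0}^∞ (Γ(μ)/(m! Γ(λm+μ))) z^{m+1}` (the `m = 0` term is `z`). -/
noncomputable def normWright (lam mu : ℝ) (z : ℂ) : ℂ :=
  ∑' m : ℕ, ((Real.Gamma mu / (Nat.factorial m * Real.Gamma (lam * m + mu)) : ℝ) : ℂ) * z ^ (m + 1)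

theorem wr_aux_pow (mu : ℝ) (hmu : 0 < mu) (m : ℕ) :
    mu * Real.Gamma mu * (2 * (mu + 1)) ^ m ≤
      Nat.factorial (m + 1) * Real.Gamma ((m : ℝ) + 1 + mu) := by
  induction m with
  | zero =>
    have h := Real.Gamma_add_one hmu.ne'
    simp only [pow_zero, mul_one, Nat.cast_zero, zero_add, Nat.factorial_one, Nat.cast_one, one_mul]
    rw [add_comm, h]
  | succ k ih =>
    have hk : (0 : ℝ) ≤ k := Nat.cast_nonneg k
    have hp : (0 : ℝ) < (k : ℝ) + 1 + mu := by positivity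
    have hG := Real.Gamma_pos_of_pos hp
    have e : ((k + 1 : ℕ) : ℝ) + 1 + mu = ((k : ℝ) + 1 + mu) + 1 := by push_cast; ring
    rw [e, Real.Gamma_add_one hp.ne', Nat.factorial_succ (k + 1), pow_succ]
    push_cast
    have hf : (0 : ℝ) ≤ Nat.factorial (k + 1) * Real.Gamma ((k : ℝ) + 1 + mu) := by positivity
    calc mu * Real.Gamma mu * ((2 * (mu + 1)) ^ k * (2 * (mu + 1)))
        = (mu * Real.Gamma mu * (2 * (mu + 1)) ^ k) * (2 * (mu + 1)) := by ring
      _ ≤ (Nat.factorial (k + 1) * Real.Gamma ((k : ℝ) + 1 + mu)) * (2 * (mu + 1)) := by gcongr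
      _ ≤ (Nat.factorial (k + 1) * Real.Gamma ((k : ℝ) + 1 + mu)) *
            (((k : ℝ) + 1 + 1) * ((k : ℝ) + 1 + mu)) := by
          apply mul_le_mul_of_nonneg_left _ hf
          nlinarith [mul_nonneg hk hk, mul_nonneg hk hmu.le]
      _ = _ := by ring

theorem wr_Gamma_mono {a b : ℝ} (ha : 2 ≤ a) (hab : a ≤ b) : Real.Gamma a ≤ Real.Gamma b :=
  Real.Gamma_strictMonoOn_Ici.monotoneOn ha (ha.trans hab) hab

theorem wr_Gamma_ge {y : ℝ} (h1 : 0 < y) (h2 : y ≤ 2) : y - 1 ≤ Real.Gamma y := by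
  have h3 : 0 < 3 - y := by linarith
  have := Real.convexOn_Gamma.2 (show y ∈ Set.Ioi (0 : ℝ) from h1)
    (show (3 : ℝ) ∈ Set.Ioi (0 : ℝ) by norm_num)
    (show 0 ≤ 1 / (3 - y) by positivity)
    (show 0 ≤ (2 - y) / (3 - y) from div_nonneg (by linarith) h3.le) (by field_simp; ring)
  have e : (1 / (3 - y)) • y + ((2 - y) / (3 - y)) • (3 : ℝ) = 2 := by
    simp only [smul_eq_mul]; field_simp; ring
  have g3 : Real.Gamma 3 = 2 := by
    rw [show (3 : ℝ) = 2 + 1 by norm_num, Real.Gamma_add_one two_ne_zero, Real.Gamma_two, mul_one]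
  rw [e, Real.Gamma_two, g3] at this
  simp only [smul_eq_mul] at this
  field_simp at this
  linarith

theorem wr_Gamma_le {y : ℝ} (h1 : 1 ≤ y) (h2 : y ≤ 2) : Real.Gamma y ≤ 1 := by
  have := Real.convexOn_Gamma.2 (show (1 : ℝ) ∈ Set.Ioi (0 : ℝ) by norm_num)
    (show (2 : ℝ) ∈ Set.Ioi (0 : ℝ) by norm_num)
    (show 0 ≤ 2 - y by linarith) (show 0 ≤ y - 1 by linarith) (by ring)
  have e : (2 - y) • (1 : ℝ) + (y - 1) • (2 : ℝ) = y := by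
    simp only [smul_eq_mul]; ring
  rw [e, Real.Gamma_two, Real.Gamma_one] at this
  simp only [smul_eq_mul] at this
  linarith

/-- bound for the term of index one -/
theorem wr_first (lam mu : ℝ) (hlam : 1 ≤ lam) (hmu : 1 / 2 < mu) :
    Real.Gamma mu / Real.Gamma (lam + mu) ≤
      (2 * mu + 1) / (2 * mu - 1) - 1 - 1 / (mu * (2 * mu + 1)) := by
  have hmu0 : 0 < mu := by linarith
  have hd : 0 < 2 * mu - 1 := by linarith
  have hG := Real.Gamma_pos_of_pos (show 0 < lam + mu by linarith)
  have hs := Real.Gamma_add_one hmu0.ne'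
  rcases le_or_gt 1 mu with h | h
  · have hm := wr_Gamma_mono (a := mu + 1) (b := lam + mu) (by linarith) (by linarith)
    have : Real.Gamma mu / Real.Gamma (lam + mu) ≤ 1 / mu := by
      rw [div_le_div_iff₀ hG hmu0]; linarith
    refine this.trans ?_
    rw [← sub_nonneg]
    have : (2 * mu + 1) / (2 * mu - 1) - 1 - 1 / (mu * (2 * mu + 1)) - 1 / mu
      = 2 / (mu * (2 * mu + 1) * (2 * mu - 1)) := by field_simp; ring
    rw [this]; positivity
  · have hl : mu ≤ Real.Gamma (lam + mu) := by
      rcases le_total (lam + mu) 2 with h2 | h2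
      · have := wr_Gamma_ge (y := lam + mu) (by linarith) h2
        linarith
      · have := wr_Gamma_mono (le_refl 2) h2
        rw [Real.Gamma_two] at this; linarith
    have hu := wr_Gamma_le (y := mu + 1) (by linarith) (by linarith)
    have : Real.Gamma mu / Real.Gamma (lam + mu) ≤ 1 / mu ^ 2 := by
      rw [div_le_div_iff₀ hG (by positivity)]
      nlinarith
    refine this.trans ?_
    rw [← sub_nonneg]
    have : (2 * mu + 1) / (2 * mu - 1) - 1 - 1 / (mu * (2 * mu + 1)) - 1 / mu ^ 2
      = (mu * (2 * mu - 1) ^ 2 + 1) / (mu ^ 2 * (2 * mu + 1) * (2 * mu - 1)) := by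
      field_simp; ring
    rw [this]; positivity

/-- If `λ ≥ 1` and `μ > 1/2`, then `|𝒲_{λ,μ}(z)| ≤ (2μ+1)/(2μ-1)` on the open unit disc. -/
theorem abs_normWright_le (lam mu : ℝ) (hlam : 1 ≤ lam) (hmu : 1 / 2 < mu) :
    ∀ z : ℂ, ‖z‖ < 1 → ‖normWright lam mu z‖ ≤ (2 * mu + 1) / (2 * mu - 1) := by
  intro z hz
  have hmu0 : 0 < mu := by linarith
  have hGm := Real.Gamma_pos_of_pos hmu0
  set r : ℝ := 1 / (2 * (mu + 1)) with hr
  have hr0 : 0 ≤ r := by positivity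
  have hr1 : r < 1 := by rw [hr, div_lt_one (by positivity)]; linarith
  let T : ℝ := (2 * mu + 1) / (2 * mu - 1) - 1 - 1 / (mu * (2 * mu + 1))
  let g : ℕ → ℝ := fun m => if m = 0 then 1 else if m = 1 then T else (1 / mu) * r ^ (m - 1)
  have hg : HasSum g ((2 * mu + 1) / (2 * mu - 1)) := by
    rw [← hasSum_nat_add_iff' 2]
    have h := (hasSum_geometric_of_lt_one hr0 hr1).mul_left (1 / mu * r)
    have e1 : (fun n => g (n + 2)) = fun i => 1 / mu * r * r ^ i := by
      funext n
      simp only [g]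
      rw [if_neg (by omega), if_neg (by omega), show n + 2 - 1 = n + 1 by omega, pow_succ]
      ring
    have e2 : (2 * mu + 1) / (2 * mu - 1) - ∑ i ∈ Finset.range 2, g i
        = 1 / mu * r * (1 - r)⁻¹ := by
      have h1 : 1 - r = (2 * mu + 1) / (2 * (mu + 1)) := by rw [hr]; field_simp; ring
      have h2 : 1 / mu * r * (1 - r)⁻¹ = 1 / (mu * (2 * mu + 1)) := by
        rw [h1, hr]; field_simp
      rw [h2]
      simp only [Finset.sum_range_succ, Finset.sum_range_zero, g, T]
      simp only [if_true, one_ne_zero, if_false]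
      ring
    rw [e1, e2]
    exact h
  unfold normWright
  refine tsum_of_norm_bounded hg fun m => ?_
  have hm0 : (0 : ℝ) ≤ m := Nat.cast_nonneg m
  have hGp := Real.Gamma_pos_of_pos (show 0 < lam * m + mu by positivity)
  rw [norm_mul, norm_pow, Complex.norm_real, Real.norm_of_nonneg (by positivity)]
  refine (mul_le_of_le_one_right (by positivity) (pow_le_one₀ (norm_nonneg z) hz.le)).trans ?_
  rcases m with _ | _ | k
  · simp [g, hGm.ne']
  · have := wr_first lam mu hlam hmu
    simpa [g, T] using this
  · have hk : (0 : ℝ) ≤ k := Nat.cast_nonneg k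
    have h := wr_aux_pow mu hmu0 (k + 1)
    have hmono : Real.Gamma (((k + 1 : ℕ) : ℝ) + 1 + mu)
        ≤ Real.Gamma (lam * ((k + 1 + 1 : ℕ) : ℝ) + mu) := by
      apply wr_Gamma_mono
      · push_cast; linarith
      · push_cast; nlinarith
    have h2 : mu * Real.Gamma mu * (2 * (mu + 1)) ^ (k + 1) ≤
        Nat.factorial (k + 1 + 1) * Real.Gamma (lam * ((k + 1 + 1 : ℕ) : ℝ) + mu) :=
      h.trans (by gcongr)
    simp only [g]
    rw [if_neg (by omega), if_neg (by omega), show k + 1 + 1 - 1 = k + 1 by omega, hr, div_pow,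
      one_pow, div_mul_div_comm, div_le_div_iff₀ (by positivity) (by positivity)]
    linarith
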